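/- arXiv:2005.13861 — 2 statements merged into one kernel-verified Lean document; each statement's English description precedes it below -/
import Mathlib

section
/- Let C be a triangulated category equipped with a cotorsion pair (S,V) such that K := add(S*V) is functorially finite in C. Then for every morphism f in the class 𝕍 := udef ∘ tinf, the morphism ϖ(f) is regular in the additive quotient C/K, i.e., ϖ(f) is both a monomorphism and an epimorphism; in particular this holds for every f ∈ udef and every f ∈ tinf. -/
universe w v u v₂ u₂

open CategoryTheory Category Limits Pretriangulated

namespace PaperFormalization

variable (C : Type u) [Category.{v} C] [Preadditive C] [HasZeroObject C]
  [HasShift C ℤ] [∀ n : ℤ, (shiftFunctor C n).Additive] [Pretriangulated C]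
  [IsTriangulated C] [HasBinaryBiproducts C]

/-- `X` is a direct summand of `Z`. -/
def IsSummandOf (X Z : C) : Prop := ∃ (i : X ⟶ Z) (p : Z ⟶ X), i ≫ p = 𝟙 X

/-- The morphism `f` factors through some object of `A`. -/
def FactorsThruSet (A : Set C) {X Y : C} (f : X ⟶ Y) : Prop :=
  ∃ Z ∈ A, ∃ (a : X ⟶ Z) (b : Z ⟶ Y), a ≫ b = f

/-- A cotorsion pair `(S, V)` supported on the (triangulated) subcategory determined by
`N ⊆ C`: both classes are contained in `N`, each is closed under isomorphisms, finite
direct sums and direct summands, `Hom(S, V⟦1⟧) = 0`, and every object of `N` admits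
distinguished triangles `V' → S' → X → V'⟦1⟧` and `X → V' → S' → X⟦1⟧` with `S' ∈ S`,
`V' ∈ V`. -/
structure IsTriCotorsionPairOn (N S V : Set C) : Prop where
  S_sub : S ⊆ N
  V_sub : V ⊆ N
  S_iso : ∀ {X Y : C}, (X ≅ Y) → X ∈ S → Y ∈ S
  S_sum : ∀ {X Y : C}, X ∈ S → Y ∈ S → (X ⊞ Y) ∈ S
  S_summand : ∀ {X Z : C}, Z ∈ S → IsSummandOf C X Z → X ∈ S
  V_iso : ∀ {X Y : C}, (X ≅ Y) → X ∈ V → Y ∈ V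
  V_sum : ∀ {X Y : C}, X ∈ V → Y ∈ V → (X ⊞ Y) ∈ V
  V_summand : ∀ {X Z : C}, Z ∈ V → IsSummandOf C X Z → X ∈ V
  orth : ∀ {A B : C}, A ∈ S → B ∈ V → ∀ f : A ⟶ (B⟦(1 : ℤ)⟧), f = 0
  resolve : ∀ X ∈ N, ∃ (Vx Sx : C), Vx ∈ V ∧ Sx ∈ S ∧
    ∃ (f : Vx ⟶ Sx) (g : Sx ⟶ X) (h : X ⟶ (Vx⟦(1 : ℤ)⟧)),
      Triangle.mk f g h ∈ distTriang C
  coresolve : ∀ X ∈ N, ∃ (Vx Sx : C), Vx ∈ V ∧ Sx ∈ S ∧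
    ∃ (f : X ⟶ Vx) (g : Vx ⟶ Sx) (h : Sx ⟶ (X⟦(1 : ℤ)⟧)),
      Triangle.mk f g h ∈ distTriang C

/-- A cotorsion pair `(S, V)` on the triangulated category `C` itself. -/
abbrev IsTriCotorsionPair (S V : Set C) : Prop := IsTriCotorsionPairOn C Set.univ S V

/-- The subcategory `C⁻` of objects `X` admitting a distinguished triangle
`X → W → S → X⟦1⟧` with `W ∈ S ∩ V` and `S ∈ S`. -/
def Cminus (S V : Set C) : Set C :=
  {X | ∃ (W' S' : C), W' ∈ S ∩ V ∧ S' ∈ S ∧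
    ∃ (f : X ⟶ W') (g : W' ⟶ S') (h : S' ⟶ (X⟦(1 : ℤ)⟧)),
      Triangle.mk f g h ∈ distTriang C}

/-- The subcategory `C⁺` of objects `X` admitting a distinguished triangle
`V → W → X → V⟦1⟧` with `V ∈ V` and `W ∈ S ∩ V`. -/
def Cplus (S V : Set C) : Set C :=
  {X | ∃ (V' W' : C), V' ∈ V ∧ W' ∈ S ∩ V ∧
    ∃ (f : V' ⟶ W') (g : W' ⟶ X) (h : X ⟶ (V'⟦(1 : ℤ)⟧)),
      Triangle.mk f g h ∈ distTriang C}

/-- The subcategory `H = C⁺ ∩ C⁻`. -/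
def Hcl (S V : Set C) : Set C := Cplus C S V ∩ Cminus C S V

/-- The class `tinf` of `T`-inflations `ι : X ⟶ T`: `T ∈ C⁺`, there is a distinguished
triangle `X →ι T → S → X⟦1⟧` with `S ∈ S`, and every morphism from `X` to an object of
`C⁺` factors through `ι`. -/
def tinf (S V : Set C) : MorphismProperty C := fun X T ι =>
  T ∈ Cplus C S V ∧
  (∃ (S' : C), S' ∈ S ∧ ∃ (g : T ⟶ S') (h : S' ⟶ (X⟦(1 : ℤ)⟧)),
      Triangle.mk ι g h ∈ distTriang C) ∧
  (∀ T' ∈ Cplus C S V, ∀ f : X ⟶ T', ∃ t : T ⟶ T', ι ≫ t = f)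

/-- The class `udef` of `U`-deflations `p : U ⟶ Y`: `U ∈ C⁻`, there is a distinguished
triangle `V → U →p Y → V⟦1⟧` with `V ∈ V`, and every morphism from an object of `C⁻`
to `Y` factors through `p`. -/
def udef (S V : Set C) : MorphismProperty C := fun U Y p =>
  U ∈ Cminus C S V ∧
  (∃ (V' : C), V' ∈ V ∧ ∃ (f : V' ⟶ U) (h : Y ⟶ (V'⟦(1 : ℤ)⟧)),
      Triangle.mk f p h ∈ distTriang C) ∧
  (∀ U' ∈ Cminus C S V, ∀ f : U' ⟶ Y, ∃ t : U' ⟶ U, t ≫ p = f)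

/-- The class `𝕍 := udef ∘ tinf`. -/
def Vclass (S V : Set C) : MorphismProperty C := fun X Y f =>
  ∃ (Z : C) (ι : X ⟶ Z) (p : Z ⟶ Y), tinf C S V ι ∧ udef C S V p ∧ ι ≫ p = f

/-- The class `S * V` of objects `Y` admitting a distinguished triangle
`S → Y → V → S⟦1⟧` with `S ∈ S`, `V ∈ V`. -/
def SstarV (S V : Set C) : Set C :=
  {Y | ∃ (S' V' : C), S' ∈ S ∧ V' ∈ V ∧
    ∃ (f : S' ⟶ Y) (g : Y ⟶ V') (h : V' ⟶ (S'⟦(1 : ℤ)⟧)),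
      Triangle.mk f g h ∈ distTriang C}

/-- Membership in the additive closure of `A`: closure of `A` under isomorphisms,
finite direct sums and direct summands. -/
inductive addMem (A : Set C) : C → Prop
  | of {X : C} : X ∈ A → addMem A X
  | iso {X Y : C} : (X ≅ Y) → addMem A X → addMem A Y
  | sum {X Y : C} : addMem A X → addMem A Y → addMem A (X ⊞ Y)
  | summand {X Z : C} : addMem A Z → IsSummandOf C X Z → addMem A X

/-- `K := add (S * V)`. -/
def Kcl (S V : Set C) : Set C := {X | addMem C (SstarV C S V) X}

/-- `A` is functorially finite: every object has a left `A`-approximation and a right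
`A`-approximation. -/
def FunctoriallyFinite (A : Set C) : Prop :=
  (∀ X : C, ∃ K ∈ A, ∃ ι : X ⟶ K, ∀ K' ∈ A, ∀ f : X ⟶ K', ∃ t : K ⟶ K', ι ≫ t = f) ∧
  (∀ X : C, ∃ K ∈ A, ∃ p : K ⟶ X, ∀ K' ∈ A, ∀ f : K' ⟶ X, ∃ t : K' ⟶ K, t ≫ p = f)

/-- The ideal-quotient relation on `C` modulo morphisms factoring through `K`;
the corresponding quotient category is the additive quotient `C/K`. -/
def Krel (S V : Set C) : HomRel C :=
  fun {X Y} f g => FactorsThruSet C (Kcl C S V) (f - g)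

/-- The additive quotient `C/K`. -/
abbrev KQuot (S V : Set C) := CategoryTheory.Quotient (Krel C S V)

/-- The additive quotient functor `ϖ : C ⥤ C/K`. -/
abbrev Kproj (S V : Set C) : C ⥤ KQuot C S V :=
  CategoryTheory.Quotient.functor (Krel C S V)

section

set_option linter.unusedSectionVars false

variable {C}

open scoped ZeroObject

section Triangles

variable {X Y Z : C} {f : X ⟶ Y} {g : Y ⟶ Z} {h : Z ⟶ X⟦(1 : ℤ)⟧}

lemma exists_desc₂_of_distTriang (hT : Triangle.mk f g h ∈ distTriang C) {B : C}
    (u : Y ⟶ B) (hu : f ≫ u = 0) : ∃ t : Z ⟶ B, u = g ≫ t :=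
  Triangle.yoneda_exact₂ _ hT u hu

lemma exists_lift₂_of_distTriang (hT : Triangle.mk f g h ∈ distTriang C) {B : C}
    (u : B ⟶ Y) (hu : u ≫ g = 0) : ∃ t : B ⟶ X, u = t ≫ f :=
  Triangle.coyoneda_exact₂ _ hT u hu

lemma exists_lift₃_of_distTriang (hT : Triangle.mk f g h ∈ distTriang C) {B : C}
    (u : B ⟶ Z) (hu : u ≫ h = 0) : ∃ t : B ⟶ Y, u = t ≫ g :=
  Triangle.coyoneda_exact₃ _ hT u hu

lemma exists_shifted_lift_of_distTriang (hT : Triangle.mk f g h ∈ distTriang C) {B : C}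
    (u : B ⟶ Y⟦(1 : ℤ)⟧) (hu : u ≫ g⟦(1 : ℤ)⟧' = 0) :
    ∃ t : B ⟶ X⟦(1 : ℤ)⟧, u = t ≫ f⟦(1 : ℤ)⟧' := by
  obtain ⟨t, ht⟩ : ∃ t : B ⟶ X⟦(1 : ℤ)⟧, u = t ≫ (-f⟦(1 : ℤ)⟧') :=
    Triangle.coyoneda_exact₃ _ (rot_of_distTriang _ (rot_of_distTriang _ hT)) u
      (show u ≫ (-g⟦(1 : ℤ)⟧') = 0 by rw [Preadditive.comp_neg, hu, neg_zero])
  exact ⟨-t, by rw [ht, Preadditive.comp_neg, Preadditive.neg_comp]⟩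

lemma exists_middle_of_distTriang {X' Y' Z' : C} {f' : X' ⟶ Y'} {g' : Y' ⟶ Z'}
    {h' : Z' ⟶ X'⟦(1 : ℤ)⟧} (hT : Triangle.mk f g h ∈ distTriang C)
    (hT' : Triangle.mk f' g' h' ∈ distTriang C) (a : X ⟶ X') (c : Z ⟶ Z')
    (comm : h ≫ a⟦(1 : ℤ)⟧' = c ≫ h') :
    ∃ b : Y ⟶ Y', f ≫ b = a ≫ f' ∧ g ≫ c = b ≫ g' :=
  complete_distinguished_triangle_morphism₂ _ _ hT hT' a c comm

/-- A morphism out of the first vertex extends along the first edge of a distinguished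
triangle as soon as its shift kills the connecting morphism. -/
lemma exists_extension_of_distTriang (hT : Triangle.mk f g h ∈ distTriang C) {B : C}
    (u : X ⟶ B) (hu : h ≫ u⟦(1 : ℤ)⟧' = 0) : ∃ t : Y ⟶ B, f ≫ t = u := by
  obtain ⟨t, ht, -⟩ := exists_middle_of_distTriang hT (contractible_distinguished B) u 0
    (hu.trans zero_comp.symm)
  exact ⟨t, ht.trans (comp_id u)⟩

end Triangles

/-- A product of a pair of objects is a retract of their biproduct. -/
lemma isSummandOf_pi_biprod (F : WalkingPair → C) [HasProduct F] :
    IsSummandOf C (∏ᶜ F) (F .left ⊞ F .right) := by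
  refine ⟨biprod.lift (Pi.π F .left) (Pi.π F .right),
    Pi.lift (fun j => match j with | .left => biprod.fst | .right => biprod.snd), ?_⟩
  refine Pi.hom_ext _ _ fun j => ?_
  cases j <;> simp

/-- The biproduct of a pair of objects is a retract of their product. -/
lemma isSummandOf_biprod_pi (F : WalkingPair → C) [HasProduct F] :
    IsSummandOf C (F .left ⊞ F .right) (∏ᶜ F) := by
  refine ⟨Pi.lift (fun j => match j with | .left => biprod.fst | .right => biprod.snd),
    biprod.lift (Pi.π F .left) (Pi.π F .right), ?_⟩
  apply biprod.hom_ext <;> simp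

lemma IsSummandOf.trans {X Y Z : C} (h₁ : IsSummandOf C X Y) (h₂ : IsSummandOf C Y Z) :
    IsSummandOf C X Z := by
  obtain ⟨i, p, h⟩ := h₁
  obtain ⟨j, q, h'⟩ := h₂
  exact ⟨i ≫ j, q ≫ p, by rw [assoc, reassoc_of% h', h]⟩

lemma IsSummandOf.biprod {X Y X' Y' : C} (h₁ : IsSummandOf C X X')
    (h₂ : IsSummandOf C Y Y') : IsSummandOf C (X ⊞ Y) (X' ⊞ Y') := by
  obtain ⟨i, p, h⟩ := h₁
  obtain ⟨j, q, h'⟩ := h₂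
  refine ⟨biprod.map i j, biprod.map p q, ?_⟩
  apply biprod.hom_ext' <;> simp [reassoc_of% h, reassoc_of% h']

lemma zero_mem_S {S V : Set C} (hP : IsTriCotorsionPair C S V) : (0 : C) ∈ S := by
  obtain ⟨_, X, _, hX, -⟩ := hP.resolve 0 (Set.mem_univ _)
  exact hP.S_summand hX ⟨0, 0, Subsingleton.elim _ _⟩

lemma zero_mem_V {S V : Set C} (hP : IsTriCotorsionPair C S V) : (0 : C) ∈ V := by
  obtain ⟨X, _, hX, -⟩ := hP.resolve 0 (Set.mem_univ _)
  exact hP.V_summand hX ⟨0, 0, Subsingleton.elim _ _⟩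

/-- `S` is the left orthogonal of `V⟦1⟧`. -/
lemma mem_S_of_orth {S V : Set C} (hP : IsTriCotorsionPair C S V) {X : C}
    (h : ∀ B ∈ V, ∀ f : X ⟶ B⟦(1 : ℤ)⟧, f = 0) : X ∈ S := by
  obtain ⟨V₁, S₁, hV, hS, f, g, d, hT⟩ := hP.resolve X (Set.mem_univ _)
  obtain ⟨s, hs⟩ := exists_lift₃_of_distTriang hT (𝟙 X) (by rw [id_comp, h _ hV d])
  exact hP.S_summand hS ⟨s, g, hs.symm⟩

/-- `V⟦1⟧` is the right orthogonal of `S`. -/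
lemma mem_V_of_orth {S V : Set C} (hP : IsTriCotorsionPair C S V) {X : C}
    (h : ∀ A ∈ S, ∀ f : A ⟶ X⟦(1 : ℤ)⟧, f = 0) : X ∈ V := by
  obtain ⟨V₁, S₁, hV, hS, f, g, d, hT⟩ := hP.coresolve X (Set.mem_univ _)
  obtain ⟨t, ht⟩ := exists_extension_of_distTriang hT (𝟙 X) (by simp [h _ hS d])
  exact hP.V_summand hV ⟨f, t, ht⟩

lemma S_extension {S V : Set C} (hP : IsTriCotorsionPair C S V) {X Y Z : C}
    {f : X ⟶ Y} {g : Y ⟶ Z} {h : Z ⟶ X⟦(1 : ℤ)⟧}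
    (hT : Triangle.mk f g h ∈ distTriang C) (hX : X ∈ S) (hZ : Z ∈ S) : Y ∈ S := by
  refine mem_S_of_orth hP fun B hB u => ?_
  obtain ⟨t, ht⟩ := exists_desc₂_of_distTriang hT u (hP.orth hX hB _)
  rw [ht, hP.orth hZ hB t, comp_zero]

lemma V_extension {S V : Set C} (hP : IsTriCotorsionPair C S V) {X Y Z : C}
    {f : X ⟶ Y} {g : Y ⟶ Z} {h : Z ⟶ X⟦(1 : ℤ)⟧}
    (hT : Triangle.mk f g h ∈ distTriang C) (hX : X ∈ V) (hZ : Z ∈ V) : Y ∈ V := by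
  refine mem_V_of_orth hP fun A hA u => ?_
  obtain ⟨t, rfl⟩ := exists_shifted_lift_of_distTriang hT u (hP.orth hA hZ _)
  rw [hP.orth hA hX t, zero_comp]

lemma hom_eq_zero_of_shift_mem {S V : Set C} (hP : IsTriCotorsionPair C S V) {L B : C}
    (hL : L⟦(1 : ℤ)⟧ ∈ S) (hB : B ∈ V) (f : L ⟶ B) : f = 0 :=
  (shiftFunctor C (1 : ℤ)).map_injective (by simpa using hP.orth hL hB (f⟦(1 : ℤ)⟧'))

/-- Every object is the middle term of a distinguished triangle from `S⟦-1⟧ * V`. -/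
lemma exists_desuspended_coresolution {S V : Set C} (hP : IsTriCotorsionPair C S V) (Y : C) :
    ∃ (L B : C) (l : L ⟶ Y) (c : Y ⟶ B) (d : B ⟶ L⟦(1 : ℤ)⟧),
      L⟦(1 : ℤ)⟧ ∈ S ∧ B ∈ V ∧ Triangle.mk l c d ∈ distTriang C := by
  obtain ⟨B, A, hB, hA, f, g, h, hT⟩ := hP.coresolve Y (Set.mem_univ _)
  exact ⟨_, _, _, _, _, hP.S_iso ((shiftEquiv C (1 : ℤ)).counitIso.app A).symm hA, hB,
    inv_rot_of_distTriang _ hT⟩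

lemma mem_Cminus_of_shift_mem {S V : Set C} (hP : IsTriCotorsionPair C S V) {L : C}
    (hL : L⟦(1 : ℤ)⟧ ∈ S) : L ∈ Cminus C S V :=
  ⟨0, _, ⟨zero_mem_S hP, zero_mem_V hP⟩, hL, _, _, _,
    rot_of_distTriang _ (contractible_distinguished L)⟩

lemma shift_mem_Cplus {S V : Set C} (hP : IsTriCotorsionPair C S V) {B : C}
    (hB : B ∈ V) : B⟦(1 : ℤ)⟧ ∈ Cplus C S V :=
  ⟨B, 0, hB, ⟨zero_mem_S hP, zero_mem_V hP⟩, _, _, _,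
    rot_of_distTriang _ (contractible_distinguished B)⟩

lemma S_subset_SstarV {S V : Set C} (hP : IsTriCotorsionPair C S V) : S ⊆ SstarV C S V :=
  fun X hX => ⟨X, 0, hX, zero_mem_V hP, _, _, _, contractible_distinguished X⟩

lemma V_subset_SstarV {S V : Set C} (hP : IsTriCotorsionPair C S V) : V ⊆ SstarV C S V :=
  fun X hX => ⟨0, X, zero_mem_S hP, hX, _, _, _, contractible_distinguished₁ X⟩

/-- `S * V` is closed under biproducts, up to direct summands. -/
lemma SstarV_biprod {S V : Set C} (hP : IsTriCotorsionPair C S V) {X Y : C}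
    (hX : X ∈ SstarV C S V) (hY : Y ∈ SstarV C S V) :
    ∃ Z ∈ SstarV C S V, IsSummandOf C (X ⊞ Y) Z := by
  obtain ⟨A, B, hA, hB, f, g, h, hT⟩ := hX
  obtain ⟨A', B', hA', hB', f', g', h', hT'⟩ := hY
  let T : WalkingPair → Triangle C := fun j =>
    match j with | .left => Triangle.mk f g h | .right => Triangle.mk f' g' h'
  have hT : ∀ j, T j ∈ distTriang C := by rintro (_ | _) <;> assumption
  exact ⟨_, ⟨_, _, hP.S_summand (hP.S_sum hA hA') (isSummandOf_pi_biprod fun j => (T j).obj₁),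
    hP.V_summand (hP.V_sum hB hB') (isSummandOf_pi_biprod fun j => (T j).obj₃),
    _, _, _, productTriangle_distinguished T hT⟩,
    isSummandOf_biprod_pi fun j => (T j).obj₂⟩

lemma Kcl_summand {S V : Set C} (hP : IsTriCotorsionPair C S V) {X : C}
    (hX : X ∈ Kcl C S V) : ∃ Z ∈ SstarV C S V, IsSummandOf C X Z := by
  induction (show addMem C (SstarV C S V) X from hX) with
  | of h => exact ⟨_, h, 𝟙 _, 𝟙 _, comp_id _⟩
  | iso e h ih =>
    obtain ⟨Z, hZ, hs⟩ := ih h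
    exact ⟨Z, hZ, IsSummandOf.trans ⟨e.inv, e.hom, e.inv_hom_id⟩ hs⟩
  | sum h h' ih ih' =>
    obtain ⟨Z, hZ, hs⟩ := ih h
    obtain ⟨Z', hZ', hs'⟩ := ih' h'
    obtain ⟨Z'', hZ'', hs''⟩ := SstarV_biprod hP hZ hZ'
    exact ⟨Z'', hZ'', (hs.biprod hs').trans hs''⟩
  | summand h hs ih =>
    obtain ⟨Z, hZ, hs'⟩ := ih h
    exact ⟨Z, hZ, hs.trans hs'⟩

lemma FactorsThruSet.to_SstarV {S V : Set C} (hP : IsTriCotorsionPair C S V) {X Y : C}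
    {f : X ⟶ Y} (hf : FactorsThruSet C (Kcl C S V) f) :
    FactorsThruSet C (SstarV C S V) f := by
  obtain ⟨Z, hZ, a, b, rfl⟩ := hf
  obtain ⟨Z', hZ', i, p, h⟩ := Kcl_summand hP hZ
  exact ⟨Z', hZ', a ≫ i, p ≫ b, by rw [assoc, reassoc_of% h]⟩

lemma FactorsThruSet.of_SstarV {S V : Set C} {X Y Z : C} (hZ : Z ∈ SstarV C S V)
    (a : X ⟶ Z) (b : Z ⟶ Y) : FactorsThruSet C (Kcl C S V) (a ≫ b) :=
  ⟨Z, .of hZ, a, b, rfl⟩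

lemma FactorsThruSet.add {S V : Set C} {X Y : C} {f g : X ⟶ Y}
    (hf : FactorsThruSet C (Kcl C S V) f) (hg : FactorsThruSet C (Kcl C S V) g) :
    FactorsThruSet C (Kcl C S V) (f + g) := by
  obtain ⟨Z, hZ, a, b, rfl⟩ := hf
  obtain ⟨Z', hZ', a', b', rfl⟩ := hg
  exact ⟨Z ⊞ Z', .sum hZ hZ', biprod.lift a a', biprod.desc b b', by simp⟩

lemma FactorsThruSet.neg {A : Set C} {X Y : C} {f : X ⟶ Y}
    (hf : FactorsThruSet C A f) : FactorsThruSet C A (-f) := by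
  obtain ⟨Z, hZ, a, b, rfl⟩ := hf
  exact ⟨Z, hZ, a, -b, by simp⟩

lemma congruence_Krel {S V : Set C} (hP : IsTriCotorsionPair C S V) :
    Congruence (Krel C S V) where
  comp_left := by
    rintro X Y Z f g g' ⟨W, hW, a, b, h⟩
    exact ⟨W, hW, f ≫ a, b, by simp [h]⟩
  comp_right := by
    rintro X Y Z f f' g ⟨W, hW, a, b, h⟩
    exact ⟨W, hW, a, b ≫ g, by simp [reassoc_of% h]⟩
  equivalence :=
    { refl := fun f => ⟨0, .of (S_subset_SstarV hP (zero_mem_S hP)), 0, 0, by simp⟩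
      symm := fun {f g} h => by simpa [Krel] using FactorsThruSet.neg h
      trans := fun {f g k} h h' => by simpa [Krel] using FactorsThruSet.add h h' }

lemma mono_Kproj_map {S V : Set C} (hP : IsTriCotorsionPair C S V) {X Y : C} {f : X ⟶ Y}
    (hf : ∀ ⦃A : C⦄ (x : A ⟶ X), FactorsThruSet C (Kcl C S V) (x ≫ f) →
      FactorsThruSet C (Kcl C S V) x) : Mono ((Kproj C S V).map f) := by
  have := congruence_Krel hP
  constructor
  rintro ⟨A⟩ g g' h
  obtain ⟨g, rfl⟩ := (Kproj C S V).map_surjective (X := A) g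
  obtain ⟨g', rfl⟩ := (Kproj C S V).map_surjective (X := A) g'
  rw [← Functor.map_comp, ← Functor.map_comp, Quotient.functor_map_eq_iff] at h
  rw [Quotient.functor_map_eq_iff]
  exact hf _ (by simpa [Krel] using h)

lemma epi_Kproj_map {S V : Set C} (hP : IsTriCotorsionPair C S V) {X Y : C} {f : X ⟶ Y}
    (hf : ∀ ⦃B : C⦄ (x : Y ⟶ B), FactorsThruSet C (Kcl C S V) (f ≫ x) →
      FactorsThruSet C (Kcl C S V) x) : Epi ((Kproj C S V).map f) := by
  have := congruence_Krel hP
  constructor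
  rintro ⟨B⟩ g g' h
  obtain ⟨g, rfl⟩ := (Kproj C S V).map_surjective (Y := B) g
  obtain ⟨g', rfl⟩ := (Kproj C S V).map_surjective (Y := B) g'
  rw [← Functor.map_comp, ← Functor.map_comp, Quotient.functor_map_eq_iff] at h
  rw [Quotient.functor_map_eq_iff]
  exact hf _ (by simpa [Krel] using h)

/-- A morphism whose cocone lies in `V` is a monomorphism modulo `K`. -/
lemma mono_Kproj_map_of_cocone_mem {S V : Set C} (hP : IsTriCotorsionPair C S V)
    {B U Y : C} {i : B ⟶ U} {p : U ⟶ Y} {h : Y ⟶ B⟦(1 : ℤ)⟧} (hB : B ∈ V)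
    (hT : Triangle.mk i p h ∈ distTriang C) : Mono ((Kproj C S V).map p) := by
  refine mono_Kproj_map hP fun A x hx => ?_
  obtain ⟨k, ⟨S₀, V₀, hS₀, hV₀, s, q, t, hk⟩, a, b, hab⟩ := hx.to_SstarV hP
  obtain ⟨m, hm⟩ : ∃ m : V₀ ⟶ B⟦(1 : ℤ)⟧, b ≫ h = q ≫ m :=
    exists_desc₂_of_distTriang hk (b ≫ h) (hP.orth hS₀ hB _)
  obtain ⟨V₁, v, j, hV₁⟩ := distinguished_cocone_triangle₂ m
  obtain ⟨k', s', q', hk'⟩ := distinguished_cocone_triangle₂ (j ≫ t)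
  obtain ⟨r, hr₁, hr₂⟩ := exists_middle_of_distTriang hk' hk (𝟙 S₀) j
    (by rw [CategoryTheory.Functor.map_id, comp_id])
  have hsr : s' ≫ r = s := by rw [hr₁, id_comp]
  have hqr : q' ≫ j = r ≫ q := hr₂
  have hk'mem : k' ∈ SstarV C S V :=
    ⟨S₀, V₁, hS₀, V_extension hP hV₁ hB hV₀, _, _, _, hk'⟩
  have hjm : j ≫ m = 0 := comp_distTriang_mor_zero₂₃ _ hV₁
  have hph : p ≫ h = 0 := comp_distTriang_mor_zero₂₃ _ hT
  have hqt : q ≫ t = 0 := comp_distTriang_mor_zero₂₃ _ hk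
  obtain ⟨a₁, ha₁⟩ : ∃ a₁ : A ⟶ V₁, a ≫ q = a₁ ≫ j :=
    exists_lift₃_of_distTriang hV₁ (a ≫ q)
      (show (a ≫ q) ≫ m = 0 by rw [assoc, ← hm, reassoc_of% hab, hph, comp_zero])
  obtain ⟨a₂, ha₂⟩ : ∃ a₂ : A ⟶ k', a₁ = a₂ ≫ q' :=
    exists_lift₃_of_distTriang hk' a₁
      (show a₁ ≫ j ≫ t = 0 by rw [← assoc, ← ha₁, assoc, hqt, comp_zero])
  obtain ⟨w, hw⟩ : ∃ w : A ⟶ S₀, a - a₂ ≫ r = w ≫ s :=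
    exists_lift₂_of_distTriang hk (a - a₂ ≫ r)
      (show (a - a₂ ≫ r) ≫ q = 0 by
        rw [Preadditive.sub_comp, assoc, ← hqr, ha₁, ha₂, assoc, sub_self])
  obtain ⟨b', hb'⟩ : ∃ b' : k' ⟶ U, r ≫ b = b' ≫ p :=
    exists_lift₃_of_distTriang hT (r ≫ b)
      (show (r ≫ b) ≫ h = 0 by
        rw [assoc, hm, ← assoc, ← hqr, assoc, hjm, comp_zero])
  have ha : (a₂ + w ≫ s') ≫ r = a := by
    rw [Preadditive.add_comp, assoc, hsr, ← hw, add_sub_cancel]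
  obtain ⟨z, hz⟩ : ∃ z : A ⟶ B, x - (a₂ + w ≫ s') ≫ b' = z ≫ i :=
    exists_lift₂_of_distTriang hT (x - (a₂ + w ≫ s') ≫ b')
      (show (x - (a₂ + w ≫ s') ≫ b') ≫ p = 0 by
        rw [Preadditive.sub_comp, assoc, ← hb', reassoc_of% ha, hab, sub_self])
  rw [← sub_add_cancel x ((a₂ + w ≫ s') ≫ b'), hz]
  exact .add (.of_SstarV (V_subset_SstarV hP hB) _ _) (.of_SstarV hk'mem _ _)

/-- A morphism whose cone lies in `S` is an epimorphism modulo `K`. -/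
lemma epi_Kproj_map_of_cone_mem {S V : Set C} (hP : IsTriCotorsionPair C S V)
    {X T A : C} {i : X ⟶ T} {g : T ⟶ A} {h : A ⟶ X⟦(1 : ℤ)⟧} (hA : A ∈ S)
    (hT : Triangle.mk i g h ∈ distTriang C) : Epi ((Kproj C S V).map i) := by
  refine epi_Kproj_map hP fun B x hx => ?_
  obtain ⟨k, ⟨S₀, V₀, hS₀, hV₀, s, q, t, hk⟩, a, b, hab⟩ := hx.to_SstarV hP
  obtain ⟨n, hn⟩ : ∃ n : A ⟶ S₀⟦(1 : ℤ)⟧, h ≫ a⟦(1 : ℤ)⟧' = n ≫ s⟦(1 : ℤ)⟧' :=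
    exists_shifted_lift_of_distTriang hk _ (hP.orth hA hV₀ _)
  obtain ⟨S₁, j, v, hS₁⟩ := distinguished_cocone_triangle₂ n
  obtain ⟨k', s', q', hk'⟩ := distinguished_cocone_triangle₂ (t ≫ j⟦(1 : ℤ)⟧')
  obtain ⟨r, hr₁, hr₂⟩ := exists_middle_of_distTriang hk hk' j (𝟙 V₀)
    (id_comp _).symm
  have hsr : s ≫ r = j ≫ s' := hr₁
  have hqr : r ≫ q' = q := by rw [← hr₂, comp_id]
  have hk'mem : k' ∈ SstarV C S V :=
    ⟨S₁, V₀, S_extension hP hS₁ hS₀ hA, hV₀, _, _, _, hk'⟩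
  have hnj : n ≫ j⟦(1 : ℤ)⟧' = 0 := comp_distTriang_mor_zero₃₁ _ hS₁
  have hhi : h ≫ i⟦(1 : ℤ)⟧' = 0 := comp_distTriang_mor_zero₃₁ _ hT
  have hts : t ≫ s⟦(1 : ℤ)⟧' = 0 := comp_distTriang_mor_zero₃₁ _ hk
  obtain ⟨u, hu⟩ := exists_extension_of_distTriang hS₁ (s ≫ b) (by
    rw [Functor.map_comp, ← assoc, ← hn, assoc, ← Functor.map_comp, hab, Functor.map_comp,
      reassoc_of% hhi, zero_comp])
  obtain ⟨y, hy⟩ := exists_extension_of_distTriang hk' u (by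
    rw [assoc, ← Functor.map_comp, hu, Functor.map_comp, reassoc_of% hts, zero_comp])
  obtain ⟨w, hw⟩ : ∃ w : V₀ ⟶ B, b - r ≫ y = q ≫ w :=
    exists_desc₂_of_distTriang hk (b - r ≫ y)
      (show s ≫ (b - r ≫ y) = 0 by
        rw [Preadditive.comp_sub, reassoc_of% hsr, hy, hu, sub_self])
  have hb : r ≫ (y + q' ≫ w) = b := by
    rw [Preadditive.comp_add, reassoc_of% hqr, ← hw, add_sub_cancel]
  obtain ⟨a', ha'⟩ := exists_extension_of_distTriang hT (a ≫ r) (by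
    rw [Functor.map_comp, reassoc_of% hn, ← Functor.map_comp, hsr, Functor.map_comp,
      reassoc_of% hnj, zero_comp])
  obtain ⟨z, hz⟩ : ∃ z : A ⟶ B, x - a' ≫ (y + q' ≫ w) = g ≫ z :=
    exists_desc₂_of_distTriang hT (x - a' ≫ (y + q' ≫ w))
      (show i ≫ (x - a' ≫ (y + q' ≫ w)) = 0 by
        rw [Preadditive.comp_sub, reassoc_of% ha', hb, hab, sub_self])
  rw [← sub_add_cancel x (a' ≫ (y + q' ≫ w)), hz]
  exact .add (.of_SstarV (S_subset_SstarV hP hA) _ _) (.of_SstarV hk'mem _ _)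

/-- A morphism through which every morphism from `S⟦-1⟧` factors is an epimorphism
modulo `K`. -/
lemma epi_Kproj_map_of_lift {S V : Set C} (hP : IsTriCotorsionPair C S V)
    {U Y : C} {p : U ⟶ Y}
    (hp : ∀ L : C, L⟦(1 : ℤ)⟧ ∈ S → ∀ f : L ⟶ Y, ∃ t : L ⟶ U, t ≫ p = f) :
    Epi ((Kproj C S V).map p) := by
  refine epi_Kproj_map hP fun B x hx => ?_
  obtain ⟨k, ⟨S₀, V₀, hS₀, hV₀, s, q, t, hk⟩, a, b, hab⟩ := hx.to_SstarV hP
  obtain ⟨L, V₁, l, c, d, hL, hV₁, hT⟩ := exists_desuspended_coresolution hP Y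
  obtain ⟨l', hl'⟩ := hp L hL l
  obtain ⟨e, he⟩ : ∃ e : L ⟶ S₀, l' ≫ a = e ≫ s :=
    exists_lift₂_of_distTriang hk (l' ≫ a) (hom_eq_zero_of_shift_mem hP hL hV₀ _)
  have hlx : e ≫ s ≫ b = l ≫ x := by
    rw [← assoc, ← he, assoc, hab, reassoc_of% hl']
  obtain ⟨P, σ, π, hP'⟩ := distinguished_cocone_triangle₂ (d ≫ e⟦(1 : ℤ)⟧')
  obtain ⟨φ, hφ, -⟩ := exists_middle_of_distTriang hT hP' e (𝟙 V₁)
    (id_comp _).symm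
  have hφ : l ≫ φ = e ≫ σ := hφ
  have hdl : d ≫ l⟦(1 : ℤ)⟧' = 0 := comp_distTriang_mor_zero₃₁ _ hT
  obtain ⟨y, hy⟩ := exists_extension_of_distTriang hP' (s ≫ b) (by
    rw [assoc, ← Functor.map_comp, hlx, Functor.map_comp, reassoc_of% hdl, zero_comp])
  obtain ⟨z, hz⟩ : ∃ z : V₁ ⟶ B, x - φ ≫ y = c ≫ z :=
    exists_desc₂_of_distTriang hT (x - φ ≫ y)
      (show l ≫ (x - φ ≫ y) = 0 by
        rw [Preadditive.comp_sub, reassoc_of% hφ, hy, hlx, sub_self])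
  rw [← sub_add_cancel x (φ ≫ y), hz]
  exact .add (.of_SstarV (V_subset_SstarV hP hV₁) _ _)
    (.of_SstarV ⟨S₀, V₁, hS₀, hV₁, _, _, _, hP'⟩ _ _)

/-- A morphism through which every morphism to `V⟦1⟧` factors is a monomorphism
modulo `K`. -/
lemma mono_Kproj_map_of_extend {S V : Set C} (hP : IsTriCotorsionPair C S V)
    {X T : C} {i : X ⟶ T}
    (hi : ∀ B ∈ V, ∀ f : X ⟶ B⟦(1 : ℤ)⟧, ∃ t : T ⟶ B⟦(1 : ℤ)⟧, i ≫ t = f) :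
    Mono ((Kproj C S V).map i) := by
  refine mono_Kproj_map hP fun A x hx => ?_
  obtain ⟨k, ⟨S₀, V₀, hS₀, hV₀, s, q, t, hk⟩, a, b, hab⟩ := hx.to_SstarV hP
  obtain ⟨V₁, S₁, hV₁, hS₁, f, g, d, hT⟩ := hP.resolve X (Set.mem_univ _)
  obtain ⟨d', hd'⟩ := hi V₁ hV₁ d
  obtain ⟨e, he⟩ : ∃ e : V₀ ⟶ V₁⟦(1 : ℤ)⟧, b ≫ d' = q ≫ e :=
    exists_desc₂_of_distTriang hk (b ≫ d') (hP.orth hS₀ hV₁ _)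
  have hxd : (a ≫ q) ≫ e = x ≫ d := by
    rw [assoc, ← he, reassoc_of% hab, hd']
  obtain ⟨Q, σ, π, hQ⟩ := distinguished_cocone_triangle₂ (-(e ≫ f⟦(1 : ℤ)⟧'))
  obtain ⟨φ, -, hφ⟩ : ∃ φ : Q ⟶ X, σ ≫ φ = 𝟙 S₁ ≫ g ∧ π ≫ e = φ ≫ d :=
    exists_middle_of_distTriang hQ (rot_of_distTriang _ hT) (𝟙 S₁) e
      (show (-(e ≫ f⟦(1 : ℤ)⟧')) ≫ (𝟙 S₁)⟦(1 : ℤ)⟧' = e ≫ (-f⟦(1 : ℤ)⟧') by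
        rw [CategoryTheory.Functor.map_id, comp_id, Preadditive.comp_neg])
  have hdf : d ≫ f⟦(1 : ℤ)⟧' = 0 := comp_distTriang_mor_zero₃₁ _ hT
  obtain ⟨y, hy⟩ : ∃ y : A ⟶ Q, a ≫ q = y ≫ π :=
    exists_lift₃_of_distTriang hQ (a ≫ q)
      (show (a ≫ q) ≫ (-(e ≫ f⟦(1 : ℤ)⟧')) = 0 by
        rw [Preadditive.comp_neg, ← assoc, hxd, assoc, hdf, comp_zero, neg_zero])
  obtain ⟨z, hz⟩ : ∃ z : A ⟶ S₁, x - y ≫ φ = z ≫ g :=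
    exists_lift₃_of_distTriang hT (x - y ≫ φ)
      (show (x - y ≫ φ) ≫ d = 0 by
        rw [Preadditive.sub_comp, assoc, ← hφ, ← assoc, ← hy, hxd, sub_self])
  rw [← sub_add_cancel x (y ≫ φ), hz]
  exact .add (.of_SstarV (S_subset_SstarV hP hS₁) _ _)
    (.of_SstarV ⟨S₁, V₀, hS₁, hV₀, _, _, _, hQ⟩ _ _)

lemma udef_regular {S V : Set C} (hP : IsTriCotorsionPair C S V) {X Y : C} {f : X ⟶ Y}
    (hf : udef C S V f) : Mono ((Kproj C S V).map f) ∧ Epi ((Kproj C S V).map f) := by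
  obtain ⟨-, ⟨B, hB, i, h, hT⟩, hlift⟩ := hf
  exact ⟨mono_Kproj_map_of_cocone_mem hP hB hT, epi_Kproj_map_of_lift hP fun L hL g =>
    hlift L (mem_Cminus_of_shift_mem hP hL) g⟩

lemma tinf_regular {S V : Set C} (hP : IsTriCotorsionPair C S V) {X Y : C} {f : X ⟶ Y}
    (hf : tinf C S V f) : Mono ((Kproj C S V).map f) ∧ Epi ((Kproj C S V).map f) := by
  obtain ⟨-, ⟨A, hA, g, h, hT⟩, hext⟩ := hf
  exact ⟨mono_Kproj_map_of_extend hP fun B hB g => hext _ (shift_mem_Cplus hP hB) g,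
    epi_Kproj_map_of_cone_mem hP hA hT⟩

end

/-- If `K = add (S * V)` is functorially finite, then `ϖ` maps every
morphism of `𝕍 = udef ∘ tinf` (in particular every `U`-deflation and every `T`-inflation)
to a regular morphism of `C/K`. -/
theorem statement16 (S V : Set C) (hP : IsTriCotorsionPair C S V)
    (hff : FunctoriallyFinite C (Kcl C S V)) :
    (∀ ⦃X Y : C⦄ (f : X ⟶ Y), Vclass C S V f →
      Mono ((Kproj C S V).map f) ∧ Epi ((Kproj C S V).map f)) ∧
    (∀ ⦃X Y : C⦄ (f : X ⟶ Y), udef C S V f →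
      Mono ((Kproj C S V).map f) ∧ Epi ((Kproj C S V).map f)) ∧
    (∀ ⦃X Y : C⦄ (f : X ⟶ Y), tinf C S V f →
      Mono ((Kproj C S V).map f) ∧ Epi ((Kproj C S V).map f)) := by
  refine ⟨?_, fun X Y f hf => udef_regular hP hf, fun X Y f hf => tinf_regular hP hf⟩
  rintro X Y f ⟨Z, ι, p, hι, hp, rfl⟩
  obtain ⟨hι₁, hι₂⟩ := tinf_regular hP hι
  obtain ⟨hp₁, hp₂⟩ := udef_regular hP hp
  rw [Functor.map_comp]
  exact ⟨mono_comp _ _, epi_comp _ _⟩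

end PaperFormalization
end

section
/- Let C be a triangulated category equipped with a cotorsion pair (S,V) such that K := add(S*V) is functorially finite in C, let R be the class of regular morphisms of C/K, and let L_R : C/K → (C/K)[R^{-1}] be the localization at R. Let A be an abelian category and H : C → A a homological functor (for every distinguished triangle X → Y → Z → X[1], the sequence H(X) → H(Y) → H(Z) is exact) such that H(X) ≅ 0 for every X ∈ K. Then there exists a functor H' : (C/K)[R^{-1}] → A, unique up to natural isomorphism, such that H ≅ H' ∘ (L_R ∘ ϖ). -/
universe w v u v₂ u₂

open CategoryTheory Category Limits Pretriangulated

namespace PaperFormalization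

variable (C : Type u) [Category.{v} C] [Preadditive C] [HasZeroObject C]
  [HasShift C ℤ] [∀ n : ℤ, (shiftFunctor C n).Additive] [Pretriangulated C]
  [IsTriangulated C] [HasBinaryBiproducts C]

/-- The class `R` of regular morphisms of `C/K`: those which are simultaneously a
monomorphism and an epimorphism. -/
def RegClass (S V : Set C) : MorphismProperty (KQuot C S V) := fun _ _ f => Mono f ∧ Epi f

variable {C}

/-- A functorially finite class is non-empty, so `K` receives all zero morphisms and the
relation defining `C/K` is a congruence. -/
lemma congruence_Krel_s17 {S V : Set C} (hff : FunctoriallyFinite C (Kcl C S V)) :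
    Congruence (Krel C S V) where
  equivalence {X _} :=
    { refl := fun _ => by
        obtain ⟨Z, hZ, -⟩ := hff.1 X
        exact ⟨Z, hZ, 0, 0, by simp⟩
      symm := by
        rintro f g ⟨Z, hZ, a, b, hab⟩
        exact ⟨Z, hZ, a, -b, by simp [hab]⟩
      trans := by
        rintro f g h ⟨Z, hZ, a, b, hab⟩ ⟨Z', hZ', a', b', hab'⟩
        exact ⟨Z ⊞ Z', addMem.sum hZ hZ', biprod.lift a a', biprod.desc b b',
          by simp [hab, hab']⟩ }
  comp_left := by
    rintro X Y W f g g' ⟨Z, hZ, a, b, hab⟩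
    exact ⟨Z, hZ, f ≫ a, b, by simp [hab]⟩
  comp_right := by
    rintro X Y W f f' g ⟨Z, hZ, a, b, hab⟩
    exact ⟨Z, hZ, a, b ≫ g, by simp [reassoc_of% hab]⟩

section

variable {A : Type u₂} [Category.{v₂} A] [Abelian A] (H : C ⥤ A) [H.Additive]

/-- An additive functor vanishing on `K` identifies morphisms congruent modulo `K`. -/
lemma map_eq_of_Krel {S V : Set C} (hK : ∀ X ∈ Kcl C S V, IsZero (H.obj X)) {X Y : C}
    {f g : X ⟶ Y} (h : Krel C S V f g) : H.map f = H.map g := by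
  obtain ⟨Z, hZ, a, b, hab⟩ := h
  rw [← sub_eq_zero, ← H.map_sub, ← hab, H.map_comp, (hK Z hZ).eq_of_tgt (H.map a) 0,
    zero_comp]

/-- A homological functor vanishing on `K` inverts the morphisms which are regular in `C/K`:
the other two morphisms of a triangle containing such a morphism vanish in `C/K`. -/
lemma isIso_map_of_regClass {S V : Set C} (hff : FunctoriallyFinite C (Kcl C S V))
    (hH : ∀ T : Triangle C, T ∈ (distTriang C) →
      ∀ w : H.map T.mor₁ ≫ H.map T.mor₂ = 0,
        (ShortComplex.mk (H.map T.mor₁) (H.map T.mor₂) w).Exact)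
    (hK : ∀ X ∈ Kcl C S V, IsZero (H.obj X)) {X Y : C} (f : X ⟶ Y)
    (hf : RegClass C S V ((Kproj C S V).map f)) : IsIso (H.map f) := by
  have := congruence_Krel_s17 hff
  have map_eq_zero {U W : C} (k : U ⟶ W)
      (hk : (Kproj C S V).map k = (Kproj C S V).map 0) : H.map k = 0 := by
    rw [map_eq_of_Krel H hK ((CategoryTheory.Quotient.functor_map_eq_iff _ _ _).1 hk), H.map_zero]
  obtain ⟨hmono, hepi⟩ := hf
  have : Epi (H.map f) := by
    obtain ⟨Z, g, h, hT⟩ := distinguished_cocone_triangle f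
    have hfg : f ≫ g = 0 := comp_distTriang_mor_zero₁₂ _ hT
    have hg : H.map g = 0 := map_eq_zero g <| by
      rw [← cancel_epi ((Kproj C S V).map f), ← Functor.map_comp, ← Functor.map_comp, hfg,
        comp_zero]
    exact (hH _ hT (by simpa using hg ▸ comp_zero)).epi_f hg
  have : Mono (H.map f) := by
    obtain ⟨Z, g, h, hT⟩ := distinguished_cocone_triangle₁ f
    have hgf : g ≫ f = 0 := comp_distTriang_mor_zero₁₂ _ hT
    have hg : H.map g = 0 := map_eq_zero g <| by
      rw [← cancel_mono ((Kproj C S V).map f), ← Functor.map_comp, ← Functor.map_comp, hgf,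
        zero_comp]
    exact (hH _ hT (by simpa using hg ▸ zero_comp)).mono_g hg
  exact isIso_of_mono_of_epi _

end

variable (C)

/-- If `K = add (S * V)` is functorially finite, `A` is abelian and
`H : C ⥤ A` is a homological functor vanishing on `K`, then `H` factors through
`L_R ∘ ϖ : C ⥤ (C/K)[R⁻¹]`, uniquely up to natural isomorphism. -/
theorem statement17 (S V : Set C) (hP : IsTriCotorsionPair C S V)
    (hff : FunctoriallyFinite C (Kcl C S V))
    {A : Type u₂} [Category.{v₂} A] [Abelian A] (H : C ⥤ A) [H.Additive]
    (hH : ∀ T : Triangle C, T ∈ (distTriang C) →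
      ∀ w : H.map T.mor₁ ≫ H.map T.mor₂ = 0,
        (ShortComplex.mk (H.map T.mor₁) (H.map T.mor₂) w).Exact)
    (hK : ∀ X ∈ Kcl C S V, IsZero (H.obj X)) :
    (∃ H' : (RegClass C S V).Localization ⥤ A,
      Nonempty ((Kproj C S V ⋙ (RegClass C S V).Q) ⋙ H' ≅ H)) ∧
    (∀ H₁ H₂ : (RegClass C S V).Localization ⥤ A,
      Nonempty ((Kproj C S V ⋙ (RegClass C S V).Q) ⋙ H₁ ≅ H) →
      Nonempty ((Kproj C S V ⋙ (RegClass C S V).Q) ⋙ H₂ ≅ H) →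
      Nonempty (H₁ ≅ H₂)) := by
  refine ⟨?_, ?_⟩
  · let G : KQuot C S V ⥤ A :=
      CategoryTheory.Quotient.lift (Krel C S V) H fun _ _ _ _ h => map_eq_of_Krel H hK h
    let e : Kproj C S V ⋙ G ≅ H := CategoryTheory.Quotient.lift.isLift _ _ _
    have hG : (RegClass C S V).IsInvertedBy G := by
      rintro ⟨X⟩ ⟨Y⟩ f hf
      obtain ⟨f, rfl⟩ := (Kproj C S V).map_surjective (X := X) (Y := Y) f
      exact isIso_map_of_regClass H hff hH hK f hf
    exact ⟨Localization.lift G hG (RegClass C S V).Q,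
      ⟨Functor.associator _ _ _ ≪≫
        Functor.isoWhiskerLeft _ (Localization.fac G hG (RegClass C S V).Q) ≪≫ e⟩⟩
  · rintro H₁ H₂ ⟨e₁⟩ ⟨e₂⟩
    let e : Kproj C S V ⋙ ((RegClass C S V).Q ⋙ H₁) ≅
        Kproj C S V ⋙ ((RegClass C S V).Q ⋙ H₂) := e₁ ≪≫ e₂.symm
    exact ⟨Localization.liftNatIso (RegClass C S V).Q (RegClass C S V) _ _ H₁ H₂
      (CategoryTheory.Quotient.natIsoLift _ e)⟩

end PaperFormalization
end
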